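/- Let $1<p<\infty$, $0<q<p$, and let $(Y,d_Y,\mu_Y)$ be a complete metric measure space with $\mu_Y$ doubling and supporting a $p$-Poincaré inequality. Fix $x_0\in Y$ and suppose $\liminf_{r\to 0^+} \mu_Y(B(x_0,r))/r^q > 0$. Then for each $r_0>0$ such that $Y\setminus B(x_0,2r_0)$ is nonempty, the variational $p$-capacity $\mathrm{cap}_p(\{x_0\}, Y\setminus B(x_0,r_0); Y)$ is positive. -/

import Mathlib

open MeasureTheory Metric Set ENNReal Filter

def IsDoubling {Y : Type*} [MetricSpace Y] [MeasurableSpace Y] (μ : Measure Y) (C : ℝ) : Prop :=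
  ∀ (x : Y) (r : ℝ), 0 < r →
    0 < μ (Metric.ball x r) ∧
      μ (Metric.ball x (2 * r)) ≤ ENNReal.ofReal C * μ (Metric.ball x r) ∧
      μ (Metric.ball x (2 * r)) < ⊤

noncomputable def codimContent {Y : Type*} [MetricSpace Y] [MeasurableSpace Y]
    (μ : Measure Y) (θ R : ℝ) (A : Set Y) : ℝ≥0∞ :=
  ⨅ (c : ℕ → Y) (ρ : ℕ → ℝ) (_ : ∀ i, 0 < ρ i ∧ ρ i ≤ R)
    (_ : A ⊆ ⋃ i, Metric.ball (c i) (ρ i)),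
    ∑' i, μ (Metric.ball (c i) (ρ i)) / ENNReal.ofReal (ρ i ^ θ)

/-- `g` is an upper gradient of `u` on `U`: for every curve in `U` parametrized by
arclength (i.e. `1`-Lipschitz on `[0, L]`), `|u(γ L) - u(γ 0)| ≤ ∫_γ g`. -/
def IsUpperGradientOn {Y : Type*} [MetricSpace Y] (u g : Y → ℝ) (U : Set Y) : Prop :=
  ∀ (L : ℝ) (γ : ℝ → Y), 0 ≤ L → LipschitzOnWith 1 γ (Set.Icc 0 L) →
    Set.MapsTo γ (Set.Icc 0 L) U →
    |u (γ L) - u (γ 0)| ≤ ∫ t in (0:ℝ)..L, g (γ t)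

noncomputable def varCap {Y : Type*} [MetricSpace Y] [MeasurableSpace Y]
    (μ : Measure Y) (p : ℝ) (E F U : Set Y) : ℝ≥0∞ :=
  ⨅ (u : Y → ℝ) (g : Y → ℝ) (_ : Measurable g) (_ : ∀ x, 0 ≤ g x)
    (_ : IsUpperGradientOn u g U) (_ : ∀ x ∈ E, 1 ≤ u x) (_ : ∀ x ∈ F, u x ≤ 0),
    ∫⁻ x in U, ENNReal.ofReal (g x ^ p) ∂μ

noncomputable def sobCap {Y : Type*} [MetricSpace Y] [MeasurableSpace Y]
    (μ : Measure Y) (p : ℝ) (A : Set Y) : ℝ≥0∞ :=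
  ⨅ (u : Y → ℝ) (g : Y → ℝ) (_ : Measurable u) (_ : Measurable g) (_ : ∀ x, 0 ≤ g x)
    (_ : IsUpperGradientOn u g Set.univ) (_ : ∀ x ∈ A, 1 ≤ u x),
    ∫⁻ x, (ENNReal.ofReal (|u x| ^ p) + ENNReal.ofReal (g x ^ p)) ∂μ

def PoincareIneq {Y : Type*} [MetricSpace Y] [MeasurableSpace Y]
    (μ : Measure Y) (p CP lam : ℝ) : Prop :=
  ∀ (x : Y) (r : ℝ) (u g : Y → ℝ), 0 < r → Measurable g → (∀ y, 0 ≤ g y) →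
    IsUpperGradientOn u g Set.univ →
    ⨍ y in Metric.ball x r, |u y - ⨍ z in Metric.ball x r, u z ∂μ| ∂μ ≤
      CP * r * (⨍ y in Metric.ball x (lam * r), g y ^ p ∂μ) ^ (1 / p)

def IsMinimalUG {Y : Type*} [MetricSpace Y] [MeasurableSpace Y]
    (μ : Measure Y) (p : ℝ) (u g : Y → ℝ) : Prop :=
  Measurable g ∧ (∀ x, 0 ≤ g x) ∧ IsUpperGradientOn u g Set.univ ∧
    ∀ g' : Y → ℝ, Measurable g' → (∀ x, 0 ≤ g' x) → IsUpperGradientOn u g' Set.univ →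
      ∫⁻ x, ENNReal.ofReal (g x ^ p) ∂μ ≤ ∫⁻ x, ENNReal.ofReal (g' x ^ p) ∂μ

open Topology in
theorem dbl_pow {Y : Type*} [MetricSpace Y] [MeasurableSpace Y] {μ : Measure Y} {C : ℝ}
    (h : IsDoubling μ C) (x : Y) (r : ℝ) (hr : 0 < r) (k : ℕ) :
    μ (ball x r) ≤ ENNReal.ofReal C ^ k * μ (ball x (r / 2 ^ k)) := by
  induction k with
  | zero => simp
  | succ k ih =>
    refine ih.trans ?_
    have := (h x (r / 2 ^ (k+1)) (by positivity)).2.1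
    have e : 2 * (r / 2 ^ (k+1)) = r / 2 ^ k := by field_simp; ring
    rw [e] at this
    calc _ ≤ ENNReal.ofReal C ^ k * (ENNReal.ofReal C * μ (ball x (r / 2 ^ (k+1)))) := by gcongr
      _ = _ := by ring

theorem dbl_fin {Y : Type*} [MetricSpace Y] [MeasurableSpace Y] {μ : Measure Y} {C : ℝ}
    (h : IsDoubling μ C) (x : Y) (r : ℝ) : μ (ball x r) < ⊤ := by
  by_cases hr : 0 < r
  · have := (h x (r/2) (by positivity)).2.2
    rwa [show 2 * (r/2) = r by ring] at this
  · rw [ball_eq_empty.2 (not_lt.1 hr)]; simp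

theorem dbl_real {Y : Type*} [MetricSpace Y] [MeasurableSpace Y] {μ : Measure Y} {C : ℝ}
    (hC : 0 ≤ C) (h : IsDoubling μ C) (x : Y) (r : ℝ) (hr : 0 < r) :
    0 < μ.real (ball x r) ∧ μ.real (ball x (2 * r)) ≤ C * μ.real (ball x r) := by
  refine ⟨ENNReal.toReal_pos (h x r hr).1.ne' (dbl_fin h x r).ne, ?_⟩
  have := ENNReal.toReal_mono (ENNReal.mul_ne_top ENNReal.ofReal_ne_top (dbl_fin h x r).ne)
    (h x r hr).2.1
  rwa [ENNReal.toReal_mul, ENNReal.toReal_ofReal hC] at this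

theorem dbl_proper {Y : Type*} [MetricSpace Y] [MeasurableSpace Y] [BorelSpace Y]
    [CompleteSpace Y] {μ : Measure Y} {C : ℝ} (h : IsDoubling μ C) : ProperSpace Y := by
  refine ProperSpace.of_isCompact_closedBall_of_le 1 fun x R hR => ?_
  refine TotallyBounded.isCompact_of_isClosed ?_ isClosed_closedBall
  rw [Metric.totallyBounded_iff]
  intro ε hε
  by_contra hcon
  push Not at hcon
  obtain ⟨f, hf1, hf2⟩ := exists_seq_of_forall_finset_exists (fun y => y ∈ closedBall x R)
    (fun y z => ε ≤ dist z y) (by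
      intro s hs
      obtain ⟨y, hy, hy2⟩ := Set.not_subset.1 (hcon (s : Set Y) s.finite_toSet)
      refine ⟨y, hy, fun z hz => ?_⟩
      by_contra hlt
      exact hy2 (Set.mem_iUnion₂.2 ⟨z, hz, by simpa using hlt⟩))
  obtain ⟨k, hk⟩ := pow_unbounded_of_one_lt (4 * R / ε) (one_lt_two)
  set m := μ (ball x (2 * R))
  have hm : 0 < m := (h x (2*R) (by linarith)).1
  have hmt : m < ⊤ := dbl_fin h _ _
  have hCpos : ENNReal.ofReal C ^ (k+1) ≠ ⊤ := ENNReal.pow_ne_top ENNReal.ofReal_ne_top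
  have key : ∀ n, m ≤ ENNReal.ofReal C ^ (k+1) * μ (ball (f n) (ε / 2)) := by
    intro n
    have h1 : m ≤ μ (ball (f n) (4 * R)) := measure_mono (by
      refine ball_subset_ball' ?_
      have := mem_closedBall.1 (hf1 n)
      rw [dist_comm] at this
      linarith)
    refine h1.trans ((dbl_pow h (f n) (4*R) (by linarith) (k+1)).trans ?_)
    gcongr ENNReal.ofReal C ^ (k+1) * μ (ball (f n) ?_)
    rw [div_le_iff₀ (by positivity)]
    rw [div_lt_iff₀ hε] at hk
    rw [pow_succ]; linarith
  have hfin : μ (⋃ n, ball (f n) (ε / 2)) ≠ ⊤ := by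
    refine ((measure_mono ?_).trans_lt (dbl_fin h x (R + ε))).ne
    refine Set.iUnion_subset fun n => ball_subset_ball' ?_
    have := mem_closedBall.1 (hf1 n)
    linarith
  have hdis : Pairwise (Function.onFun Disjoint fun n => ball (f n) (ε / 2)) := by
    intro i j hij
    refine ball_disjoint_ball ?_
    rcases lt_or_gt_of_ne hij with hl | hl
    · have := hf2 _ _ hl; rw [dist_comm] at this; linarith
    · have := hf2 _ _ hl; linarith
  have := Measure.finite_const_le_meas_of_disjoint_iUnion μ
    (ε := m / ENNReal.ofReal C ^ (k+1)) (ENNReal.div_pos hm.ne' hCpos)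
    (As := fun n => ball (f n) (ε / 2)) (fun n => measurableSet_ball) hdis hfin
  refine Set.infinite_univ (this.subset fun n _ => ?_)
  exact ENNReal.div_le_of_le_mul' (key n)

theorem avg_cmp {Y : Type*} [MetricSpace Y] [MeasurableSpace Y] [BorelSpace Y] {μ : Measure Y}
    {f : Y → ℝ} {A B : Set Y} (hAB : A ⊆ B) (hB : MeasurableSet B)
    (hf : IntegrableOn f B μ) (hBt : μ B ≠ ⊤) {M : ℝ} (hA0 : 0 < μ.real A)
    (hM : μ.real B ≤ M * μ.real A) :
    |(⨍ y in A, f y ∂μ) - ⨍ y in B, f y ∂μ| ≤ M * ⨍ y in B, |f y - ⨍ z in B, f z ∂μ| ∂μ := by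
  set c := ⨍ y in B, f y ∂μ
  have hAt : μ A ≠ ⊤ := ((measure_mono hAB).trans_lt hBt.lt_top).ne
  have hB0 : 0 < μ.real B := hA0.trans_le (measureReal_mono hAB hBt)
  have hfA : IntegrableOn f A μ := hf.mono_set hAB
  have hcB : IntegrableOn (fun y => f y - c) B μ := hf.sub (integrableOn_const hBt)
  have e1 : (⨍ y in A, f y ∂μ) - c = (μ.real A)⁻¹ * ∫ y in A, (f y - c) ∂μ := by
    rw [integral_sub hfA (integrableOn_const hAt), setAverage_eq, setIntegral_const]
    simp only [smul_eq_mul]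
    field_simp
  rw [e1, abs_mul, abs_of_nonneg (inv_nonneg.2 hA0.le), setAverage_eq, smul_eq_mul]
  have h1 : |∫ y in A, (f y - c) ∂μ| ≤ ∫ y in B, |f y - c| ∂μ :=
    abs_integral_le_integral_abs.trans
      (setIntegral_mono_set hcB.abs (ae_of_all _ fun _ => abs_nonneg _) hAB.eventuallyLE)
  have h0 : 0 ≤ ∫ y in B, |f y - c| ∂μ := integral_nonneg fun _ => abs_nonneg _
  have h2 : (μ.real A)⁻¹ ≤ M * (μ.real B)⁻¹ := by
    rw [← div_eq_mul_inv, le_div_iff₀ hB0, inv_mul_le_iff₀ hA0]; linarith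
  calc _ ≤ (μ.real A)⁻¹ * ∫ y in B, |f y - c| ∂μ := by gcongr
    _ ≤ (M * (μ.real B)⁻¹) * ∫ y in B, |f y - c| ∂μ := by gcongr
    _ = _ := by ring

open Topology in
theorem avg_tendsto {Y : Type*} [MetricSpace Y] [MeasurableSpace Y] [BorelSpace Y]
    {μ : Measure Y} {C : ℝ} (hC : 0 ≤ C) (h : IsDoubling μ C) {f : Y → ℝ} (hf : Continuous f)
    (hfi : ∀ x r, IntegrableOn f (ball x r) μ) (x : Y) (R : ℝ) (hR : 0 < R) :
    Tendsto (fun k : ℕ => ⨍ y in ball x (R * (1/2)^k), f y ∂μ) atTop (𝓝 (f x)) := by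
  rw [Metric.tendsto_atTop]
  intro ε hε
  obtain ⟨δ, hδ, hd⟩ := Metric.continuous_iff.1 hf x (ε/2) (by positivity)
  obtain ⟨N, hN⟩ := exists_pow_lt_of_lt_one (show 0 < δ / R by positivity)
    (show (1/2:ℝ) < 1 by norm_num)
  refine ⟨N, fun n hn => ?_⟩
  set r := R * (1/2:ℝ)^n
  have hr : 0 < r := by positivity
  have hrδ : r ≤ δ := by
    have : (1/2:ℝ)^n ≤ (1/2)^N := pow_le_pow_of_le_one (by norm_num) (by norm_num) hn
    rw [lt_div_iff₀ hR] at hN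
    calc r ≤ R * (1/2)^N := by simp only [r]; gcongr
      _ ≤ δ := by linarith
  have h0 := (dbl_real hC h x r hr).1
  have hft := (dbl_fin h x r)
  have e1 : (⨍ y in ball x r, f y ∂μ) - f x = (μ.real (ball x r))⁻¹ * ∫ y in ball x r, (f y - f x) ∂μ := by
    rw [integral_sub (hfi x r) (integrableOn_const hft.ne), setAverage_eq, setIntegral_const]
    simp only [smul_eq_mul]
    field_simp
  rw [Real.dist_eq, e1, abs_mul, abs_of_nonneg (inv_nonneg.2 h0.le)]
  have h1 : ‖∫ y in ball x r, (f y - f x) ∂μ‖ ≤ (ε/2) * μ.real (ball x r) :=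
    norm_setIntegral_le_of_norm_le_const hft fun y hy => by
      have := hd y ((mem_ball.1 hy).trans_le hrδ)
      rw [Real.dist_eq] at this
      exact this.le
  rw [Real.norm_eq_abs] at h1
  rw [inv_mul_lt_iff₀ h0]
  nlinarith

theorem telescope {Y : Type*} [MetricSpace Y] [MeasurableSpace Y] [BorelSpace Y]
    {μ : Measure Y} {C : ℝ} (hC : 0 ≤ C) (h : IsDoubling μ C) {f : Y → ℝ} (hf : Continuous f)
    (hfi : ∀ x r, IntegrableOn f (ball x r) μ) (x : Y) (R : ℝ) (hR : 0 < R) (D θ : ℝ)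
    (hD : 0 ≤ D) (hθ : 0 ≤ θ) (hθ1 : θ < 1)
    (ha : ∀ k : ℕ, ⨍ y in ball x (R * (1/2)^k), |f y - ⨍ z in ball x (R * (1/2)^k), f z ∂μ| ∂μ
      ≤ D * θ ^ k) :
    |(⨍ y in ball x R, f y ∂μ) - f x| ≤ C * D / (1 - θ) := by
  have h2 := dist_le_of_le_geometric_of_tendsto₀ θ (C * D) hθ1 (f := fun k : ℕ => ⨍ y in ball x (R * (1/2)^k), f y ∂μ)
    (fun k => by
      set r := R * (1/2:ℝ)^k with hrdef
      have hr : 0 < r := by positivity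
      have e : R * (1/2:ℝ)^(k+1) = r / 2 := by rw [hrdef, pow_succ]; ring
      have e2 : r = 2 * (r/2) := by ring
      have hdd := dbl_real hC h x (r/2) (by positivity)
      rw [← e2] at hdd
      rw [e, dist_comm, Real.dist_eq]
      refine (avg_cmp (ball_subset_ball (by linarith)) measurableSet_ball (hfi x r)
        (dbl_fin h x r).ne hdd.1 hdd.2).trans ?_
      rw [mul_assoc]
      exact mul_le_mul_of_nonneg_left (ha k) hC)
    (avg_tendsto hC h hf hfi x R hR)
  simpa [Real.dist_eq] using h2

/-- `y` is reached from `x` by an `ε`-chain of length `L`. -/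
inductive EpsChain {Y : Type*} [MetricSpace Y] (ε : ℝ) (x : Y) : Y → ℝ → Prop
  | refl : EpsChain ε x x 0
  | step (y z : Y) (L : ℝ) : EpsChain ε x y L → dist y z ≤ ε → EpsChain ε x z (L + dist y z)

theorem EpsChain.nonneg {Y : Type*} [MetricSpace Y] {ε : ℝ} {x y : Y} {L : ℝ}
    (h : EpsChain ε x y L) : 0 ≤ L := by
  induction h with
  | refl => exact le_rfl
  | step y z L _ _ ih => positivity

theorem EpsChain.curve {Y : Type*} [MetricSpace Y] {ε : ℝ} (hε : 0 ≤ ε) {x y : Y} {L : ℝ}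
    (h : EpsChain ε x y L) : ∃ γ : ℝ → Y, γ 0 = x ∧ (∀ s, L ≤ s → γ s = y) ∧
      ∀ s t, dist (γ s) (γ t) ≤ |s - t| + ε := by
  induction h with
  | refl => exact ⟨fun _ => x, rfl, fun _ _ => rfl, fun s t => by rw [dist_self]; positivity⟩
  | step y z L hc hd ih =>
    obtain ⟨γ, h0, h1, h2⟩ := ih
    have hL := hc.nonneg
    have hdn : 0 ≤ dist y z := dist_nonneg
    have main : ∀ s t, s < L + dist y z → L + dist y z ≤ t → dist (γ s) z ≤ |s - t| + ε := by
      intro s t hs ht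
      rw [abs_of_nonpos (by linarith)]
      rcases le_total s L with hsL | hsL
      · have := h2 s L
        rw [h1 L le_rfl, abs_of_nonpos (by linarith)] at this
        have := dist_triangle (γ s) y z
        linarith
      · rw [h1 s hsL]; linarith
    refine ⟨fun s => if s < L + dist y z then γ s else z, ?_, ?_, ?_⟩
    · simp only
      split_ifs with hlt
      · exact h0
      · have e1 : L = 0 := by linarith
        have e2 : dist y z = 0 := by linarith
        rw [← h0, h1 0 e1.le]
        exact (dist_eq_zero.1 e2).symm
    · intro s hs
      simp only
      rw [if_neg (not_lt.2 hs)]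
    · intro s t
      simp only
      split_ifs with a b b
      · exact h2 s t
      · exact main s t a (not_lt.1 b)
      · rw [dist_comm, abs_sub_comm]; exact main t s b (not_lt.1 a)
      · rw [dist_self]; positivity

/-- truncated chain distance -/
noncomputable def chainDist {Y : Type*} [MetricSpace Y] (ε M : ℝ) (x y : Y) : ℝ :=
  sInf ({L | EpsChain ε x y L} ∪ {M})

theorem chain_bdd {Y : Type*} [MetricSpace Y] {ε M : ℝ} (hM : 0 ≤ M) (x y : Y) :
    ∀ L ∈ ({L | EpsChain ε x y L} ∪ {M} : Set ℝ), 0 ≤ L := by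
  rintro L (h | h)
  · exact EpsChain.nonneg h
  · rw [Set.mem_singleton_iff.1 h]; exact hM

theorem chainDist_nonneg {Y : Type*} [MetricSpace Y] {ε M : ℝ} (hM : 0 ≤ M) (x y : Y) :
    0 ≤ chainDist ε M x y := Real.sInf_nonneg (chain_bdd hM x y)

theorem chainDist_le {Y : Type*} [MetricSpace Y] {ε M : ℝ} (hM : 0 ≤ M) (x y : Y) :
    chainDist ε M x y ≤ M := csInf_le ⟨0, chain_bdd hM x y⟩ (Or.inr rfl)

theorem chainDist_self {Y : Type*} [MetricSpace Y] {ε M : ℝ} (hM : 0 ≤ M) (x : Y) :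
    chainDist ε M x x = 0 :=
  le_antisymm (csInf_le ⟨0, chain_bdd hM x x⟩ (Or.inl EpsChain.refl)) (chainDist_nonneg hM x x)

theorem chainDist_step {Y : Type*} [MetricSpace Y] {ε M : ℝ} (hM : 0 ≤ M) (x y z : Y)
    (h : dist y z ≤ ε) : |chainDist ε M x y - chainDist ε M x z| ≤ dist y z := by
  have key : ∀ y z : Y, dist y z ≤ ε → chainDist ε M x z ≤ chainDist ε M x y + dist y z := by
    intro y z h
    rw [← sub_le_iff_le_add]
    refine le_csInf ⟨M, Or.inr rfl⟩ ?_
    rintro L (hL | hL)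
    · rw [sub_le_iff_le_add]
      exact csInf_le ⟨0, chain_bdd hM x z⟩ (Or.inl (EpsChain.step y z L hL h))
    · rw [Set.mem_singleton_iff.1 hL]
      have := chainDist_le (ε := ε) hM x z
      have := dist_nonneg (x := y) (y := z)
      linarith
  rw [abs_le]
  have h1 := key y z h
  have h2 := key z y (by rwa [dist_comm])
  rw [dist_comm z y] at h2
  constructor <;> linarith

theorem chainDist_cont {Y : Type*} [MetricSpace Y] {ε M : ℝ} (hε : 0 < ε) (hM : 0 ≤ M) (x : Y) :
    Continuous (chainDist ε M x) := by
  rw [Metric.continuous_iff]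
  intro b η hη
  refine ⟨min ε η, lt_min hε hη, fun a ha => ?_⟩
  rw [Real.dist_eq]
  exact (chainDist_step hM x a b (ha.le.trans (min_le_left _ _))).trans_lt
    (ha.trans_le (min_le_right _ _))

theorem chainDist_ug {Y : Type*} [MetricSpace Y] {ε M : ℝ} (hε : 0 < ε) (hM : 0 ≤ M) (x : Y) :
    IsUpperGradientOn (chainDist ε M x) (fun _ => 1) Set.univ := by
  intro L γ hL hγ _
  rw [intervalIntegral.integral_const]
  simp only [sub_zero, smul_eq_mul, mul_one]
  obtain ⟨n, hn⟩ := exists_nat_gt (L / ε)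
  have hn0 : (0:ℝ) < n := lt_of_le_of_lt (by positivity) hn
  rw [div_lt_iff₀ hε] at hn
  have hstep : L / n ≤ ε := by rw [div_le_iff₀ hn0]; linarith
  have : ∀ k : ℕ, k ≤ n → |chainDist ε M x (γ (k * (L / n))) - chainDist ε M x (γ 0)| ≤ k * (L/n) := by
    intro k
    induction k with
    | zero => simp
    | succ k ih =>
      intro hk
      have ih := ih (by omega)
      have mem : ∀ j : ℕ, j ≤ n → (j:ℝ) * (L/n) ∈ Icc 0 L := by
        intro j hj
        refine ⟨by positivity, ?_⟩
        have : (j:ℝ) ≤ n := by exact_mod_cast hj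
        calc (j:ℝ) * (L/n) ≤ n * (L/n) := by gcongr
          _ = L := by field_simp
      have hd := hγ.dist_le_mul _ (mem (k+1) hk) _ (mem k (by omega))
      rw [Real.dist_eq] at hd
      have e : ((k+1:ℕ):ℝ) * (L/n) - k * (L/n) = L/n := by push_cast; ring
      rw [e, abs_of_nonneg (by positivity)] at hd
      simp only [NNReal.coe_one, one_mul] at hd
      have h1 := chainDist_step hM x _ _ (hd.trans hstep)
      have h2 := abs_sub_le (chainDist ε M x (γ ((k+1:ℕ) * (L / n)))) (chainDist ε M x (γ (k * (L / n)))) (chainDist ε M x (γ 0))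
      push_cast at *
      linarith
  have := this n le_rfl
  rwa [show (n:ℝ) * (L/n) = L by field_simp] at this

theorem integrable_bdd {Y : Type*} [MetricSpace Y] [MeasurableSpace Y] [BorelSpace Y]
    {μ : Measure Y} {C : ℝ} (h : IsDoubling μ C) {f : Y → ℝ} (hf : Continuous f) (M : ℝ)
    (hM : ∀ y, |f y| ≤ M) (x : Y) (r : ℝ) : IntegrableOn f (ball x r) μ :=
  IntegrableOn.of_bound (dbl_fin h x r) hf.aestronglyMeasurable M
    (ae_of_all _ fun y => hM y)

theorem chainDist_bound {Y : Type*} [MetricSpace Y] [MeasurableSpace Y] [BorelSpace Y]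
    {μ : Measure Y} {p C CP lam : ℝ} (hC : 1 ≤ C) (hCP : 0 < CP) (hlam : 1 ≤ lam)
    (hdb : IsDoubling μ C) (hPI : PoincareIneq μ p CP lam) {ε M : ℝ} (hε : 0 < ε) (hM : 0 ≤ M)
    (x y : Y) (hxy : x ≠ y) :
    chainDist ε M x y ≤ (6 * C * CP + 2 * C ^ 2 * CP) * dist x y := by
  have hC0 : 0 ≤ C := by linarith
  set f := chainDist ε M x with hfdef
  have hf : Continuous f := chainDist_cont hε hM x
  have hfi := integrable_bdd hdb hf M (fun y => by
    rw [abs_of_nonneg (chainDist_nonneg hM x y)]; exact chainDist_le hM x y)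
  have hp1 : ∀ z r, 0 < r → ⨍ y in ball z r, |f y - ⨍ w in ball z r, f w ∂μ| ∂μ ≤ CP * r := by
    intro z r hr
    have := hPI z r f (fun _ => 1) hr measurable_const (fun _ => zero_le_one) (chainDist_ug hε hM x)
    have hlr : 0 < lam * r := by positivity
    simp only [Real.one_rpow] at this
    rw [setAverage_const (hdb z (lam*r) hlr).1.ne' (dbl_fin hdb z _).ne] at this
    simpa using this
  have tel : ∀ z r, 0 < r → |(⨍ y in ball z r, f y ∂μ) - f z| ≤ 2 * C * CP * r := by
    intro z r hr
    have := telescope hC0 hdb hf hfi z r hr (CP * r) (1/2) (by positivity) (by norm_num)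
      (by norm_num) (fun k => (hp1 z _ (by positivity)).trans_eq (by ring))
    refine this.trans_eq (by ring)
  set r := dist x y with hr
  have hr0 : 0 < r := dist_pos.2 hxy
  have t1 := tel x (2*r) (by positivity)
  have t2 := tel y r hr0
  have d1 := dbl_real hC0 hdb y r hr0
  have d2 := dbl_real hC0 hdb y (2*r) (by positivity)
  have hcmp := avg_cmp (μ := μ) (f := f) (A := ball y r) (B := ball x (2*r)) (M := C^2)
    (ball_subset_ball' (by rw [dist_comm]; linarith)) measurableSet_ball (hfi _ _)
    (dbl_fin hdb _ _).ne d1.1 (by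
      have : μ.real (ball x (2*r)) ≤ μ.real (ball y (2*(2*r))) :=
        measureReal_mono (ball_subset_ball' (by linarith)) (dbl_fin hdb _ _).ne
      nlinarith)
  have hh := hp1 x (2*r) (by positivity)
  have hh2 : C^2 * ⨍ y in ball x (2*r), |f y - ⨍ w in ball x (2*r), f w ∂μ| ∂μ ≤ C^2 * (CP * (2*r)) := by
    gcongr
  have e0 : f x = 0 := chainDist_self hM x
  rw [e0] at t1
  rw [abs_le] at *
  nlinarith

open Topology in
theorem quasiconvex {Y : Type*} [MetricSpace Y] [MeasurableSpace Y] [BorelSpace Y]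
    [CompleteSpace Y]
    {μ : Measure Y} {p C CP lam : ℝ} (hC : 1 ≤ C) (hCP : 0 < CP) (hlam : 1 ≤ lam)
    (hdb : IsDoubling μ C) (hPI : PoincareIneq μ p CP lam) :
    ∃ K : ℝ, 0 < K ∧ ∀ x y : Y, ∃ γ : ℝ → Y, γ 0 = x ∧ γ (K * dist x y) = y ∧
      LipschitzOnWith 1 γ (Icc 0 (K * dist x y)) := by
  have : ProperSpace Y := dbl_proper hdb
  set K0 := 6 * C * CP + 2 * C ^ 2 * CP
  have hK0 : 0 < K0 := by positivity
  refine ⟨K0 + 1, by positivity, fun x y => ?_⟩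
  by_cases hxy : x = y
  · subst hxy
    exact ⟨fun _ => x, rfl, rfl, LipschitzOnWith.of_dist_le_mul (by simp)⟩
  have hd : 0 < dist x y := dist_pos.2 hxy
  set L := (K0 + 1) * dist x y with hL
  have hL0 : 0 < L := by positivity
  have hch : ∀ n : ℕ, ∃ γ : ℝ → Y, γ 0 = x ∧ γ L = y ∧
      ∀ s t, dist (γ s) (γ t) ≤ |s - t| + 1 / ((n:ℝ) + 1) := by
    intro n
    have hε : (0:ℝ) < 1 / ((n:ℝ) + 1) := by positivity
    have hb := chainDist_bound hC hCP hlam hdb hPI hε hL0.le x y hxy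
    have hlt : chainDist (1 / ((n:ℝ) + 1)) L x y < L := by
      refine hb.trans_lt ?_
      rw [hL]; nlinarith
    obtain ⟨l, hl, hlL⟩ := exists_lt_of_csInf_lt ⟨L, Or.inr rfl⟩ hlt
    rcases hl with hl | hl
    · obtain ⟨γ, h0, h1, h2⟩ := EpsChain.curve hε.le hl
      exact ⟨γ, h0, h1 L hlL.le, h2⟩
    · exact absurd hlL (by rw [Set.mem_singleton_iff.1 hl]; exact lt_irrefl _)
  choose γ h0 h1 h2 using hch
  let U : Ultrafilter ℕ := Ultrafilter.of atTop
  have hU : (U : Filter ℕ) ≤ atTop := Ultrafilter.of_le atTop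
  have hlim : ∀ t, ∃ z, Tendsto (fun n => γ n t) U (𝓝 z) := by
    intro t
    have hc := isCompact_closedBall x (|t| + 1)
    obtain ⟨z, _, hz⟩ := hc.ultrafilter_le_nhds (U.map (fun n => γ n t)) (by
      rw [Filter.le_principal_iff, Ultrafilter.mem_coe, Ultrafilter.mem_map]
      refine Filter.univ_mem' fun n => ?_
      have := h2 n t 0
      rw [h0, sub_zero] at this
      have h3 : 1 / ((n:ℝ) + 1) ≤ 1 := by
        rw [div_le_one (by positivity)]; linarith [Nat.cast_nonneg (α := ℝ) n]
      simp only [Set.mem_preimage, mem_closedBall]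
      linarith)
    exact ⟨z, hz⟩
  choose σ hσ using hlim
  refine ⟨σ, ?_, ?_, ?_⟩
  · refine tendsto_nhds_unique (hσ 0) ?_
    simp only [h0]; exact tendsto_const_nhds
  · refine tendsto_nhds_unique (hσ L) ?_
    simp only [h1]; exact tendsto_const_nhds
  · refine LipschitzOnWith.of_dist_le_mul fun s _ t _ => ?_
    have l1 := (hσ s).dist (hσ t)
    have l2 : Tendsto (fun n : ℕ => |s - t| + 1 / ((n:ℝ) + 1)) U (𝓝 (|s - t| + 0)) :=
      (tendsto_const_nhds.add tendsto_one_div_add_atTop_nhds_zero_nat).mono_left hU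
    have := le_of_tendsto_of_tendsto' l1 l2 (fun n => h2 n s t)
    simpa [Real.dist_eq] using this

/-- Infinite concatenation of shrinking loops based at `x`. -/
theorem loops {Y : Type*} [MetricSpace Y] (x : Y) (τ b : ℕ → ℝ) (c : ℕ → ℝ → Y)
    (hb : ∀ n, 0 < b n) (hsep : ∀ n m, n ≠ m → b n + b m ≤ |τ n - τ m|)
    (hc0 : ∀ n, c n 0 = x) (hcl : ∀ n, LipschitzOnWith 1 (c n) (Icc 0 (b n))) :
    ∃ σ : ℝ → Y, (∀ n t, |t - τ n| ≤ b n → σ t = c n (b n - |t - τ n|)) ∧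
      (∀ t, (∀ n, b n ≤ |t - τ n|) → σ t = x) ∧ ∀ s t, dist (σ s) (σ t) ≤ |s - t| := by
  classical
  let σ : ℝ → Y := fun t =>
    if h : ∃ n, |t - τ n| < b n then c h.choose (b h.choose - |t - τ h.choose|) else x
  have uniq : ∀ n m t, |t - τ n| < b n → |t - τ m| < b m → n = m := by
    intro n m t h1 h2
    by_contra hne
    have := hsep n m hne
    have h3 := abs_sub_le (τ n) t (τ m)
    rw [abs_sub_comm (τ n) t] at h3
    linarith
  have A : ∀ n t, |t - τ n| < b n → σ t = c n (b n - |t - τ n|) := by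
    intro n t h
    have hex : ∃ n, |t - τ n| < b n := ⟨n, h⟩
    have e : hex.choose = n := uniq _ _ t hex.choose_spec h
    simp only [σ]
    rw [dif_pos hex, e]
  have B : ∀ t, (∀ n, b n ≤ |t - τ n|) → σ t = x := by
    intro t h
    simp only [σ]
    rw [dif_neg (by push Not; exact h)]
  have dx : ∀ n t, |t - τ n| < b n → dist (σ t) x ≤ b n - |t - τ n| := by
    intro n t h
    have h0 : 0 ≤ |t - τ n| := abs_nonneg _
    have := (hcl n).dist_le_mul (b n - |t - τ n|) ⟨by linarith, by linarith⟩ 0 ⟨le_rfl, (hb n).le⟩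
    rw [hc0, ← A n t h, Real.dist_eq, sub_zero, abs_of_nonneg (by linarith)] at this
    simpa using this
  have mixed : ∀ n s t, |s - τ n| < b n → (∀ m, b m ≤ |t - τ m|) → dist (σ s) (σ t) ≤ |s - t| := by
    intro n s t h1 h2
    rw [B t h2]
    have := dx n s h1
    have := h2 n
    have h3 := abs_sub_le t s (τ n)
    rw [abs_sub_comm t s] at h3
    linarith
  refine ⟨σ, ?_, B, ?_⟩
  · intro n t h
    rcases lt_or_eq_of_le h with h | h
    · exact A n t h
    · rw [h, sub_self, hc0]
      refine B t fun m => ?_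
      by_cases hmn : n = m
      · subst hmn; exact h.ge
      · have := hsep n m hmn
        have h3 := abs_sub_le (τ n) t (τ m)
        rw [abs_sub_comm (τ n) t] at h3
        linarith
  · intro s t
    by_cases hs : ∃ n, |s - τ n| < b n <;> by_cases ht : ∃ n, |t - τ n| < b n
    · obtain ⟨n, hn⟩ := hs
      obtain ⟨m, hm⟩ := ht
      by_cases hnm : n = m
      · subst hnm
        rw [A n s hn, A n t hm]
        have h0 : 0 ≤ |s - τ n| := abs_nonneg _
        have h0' : 0 ≤ |t - τ n| := abs_nonneg _
        have := (hcl n).dist_le_mul (b n - |s - τ n|) ⟨by linarith, by linarith⟩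
          (b n - |t - τ n|) ⟨by linarith, by linarith⟩
        refine this.trans ?_
        rw [Real.dist_eq]
        simp only [NNReal.coe_one, one_mul]
        have h3 := abs_abs_sub_abs_le_abs_sub (t - τ n) (s - τ n)
        rw [show b n - |s - τ n| - (b n - |t - τ n|) = |t - τ n| - |s - τ n| by ring]
        refine h3.trans_eq ?_
        rw [abs_sub_comm s t]; congr 1; ring
      · have h1 := dx n s hn
        have h2 := dx m t hm
        have h3 := dist_triangle_right (σ s) (σ t) x
        have h4 := hsep n m hnm
        have h5 := abs_sub_le (τ n) s (τ m)
        have h6 := abs_sub_le s t (τ m)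
        rw [abs_sub_comm (τ n) s] at h5
        linarith
    · obtain ⟨n, hn⟩ := hs
      push Not at ht
      exact mixed n s t hn ht
    · obtain ⟨n, hn⟩ := ht
      push Not at hs
      rw [dist_comm, abs_sub_comm]
      exact mixed n t s hn hs
    · push Not at hs ht
      rw [B s hs, B t ht, dist_self]
      exact abs_nonneg _

open Topology in
theorem ug_continuous {Y : Type*} [MetricSpace Y] {K : ℝ} (hK : 0 < K)
    (hqc : ∀ x y : Y, ∃ γ : ℝ → Y, γ 0 = x ∧ γ (K * dist x y) = y ∧
      LipschitzOnWith 1 γ (Icc 0 (K * dist x y))) (u g : Y → ℝ)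
    (hug : IsUpperGradientOn u g Set.univ) : Continuous u := by
  rw [Metric.continuous_iff]
  by_contra hcon
  push Not at hcon
  obtain ⟨x, δ, hδ, hz⟩ := hcon
  have hz' : ∀ n : ℕ, ∃ z, dist z x < (1/2:ℝ)^n / (4 * K) ∧ δ ≤ dist (u z) (u x) :=
    fun n => hz _ (by positivity)
  choose z hz1 hz2 using hz'
  have hzx : ∀ n, 0 < dist x (z n) := by
    intro n
    refine dist_pos.2 fun h => ?_
    have := hz2 n
    rw [← h, dist_self] at this
    linarith
  choose c hc0 hc1 hcl using fun n => hqc x (z n)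
  set b : ℕ → ℝ := fun n => K * dist x (z n) with hbdef
  set τ : ℕ → ℝ := fun n => (1/2:ℝ)^n with hτdef
  have hb : ∀ n, 0 < b n := fun n => mul_pos hK (hzx n)
  have hb4 : ∀ n, b n ≤ τ n / 4 := by
    intro n
    have := hz1 n
    rw [dist_comm, lt_div_iff₀ (by positivity)] at this
    simp only [hbdef, hτdef]; linarith
  have hτ : ∀ n, 0 < τ n := fun n => by simp only [hτdef]; positivity
  have hsep1 : ∀ n m, n < m → b n + b m ≤ |τ n - τ m| := by
    intro n m hnm
    have h1 : τ m ≤ τ n / 2 := by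
      have : τ m ≤ τ (n+1) := pow_le_pow_of_le_one (by norm_num) (by norm_num) hnm
      refine this.trans_eq ?_
      simp only [hτdef, pow_succ]; ring
    have := hb4 n; have := hb4 m; have := hτ n; have := hτ m
    refine le_trans ?_ (le_abs_self _)
    linarith
  have hsep : ∀ n m, n ≠ m → b n + b m ≤ |τ n - τ m| := by
    intro n m hnm
    rcases lt_or_gt_of_ne hnm with h | h
    · exact hsep1 n m h
    · rw [add_comm, abs_sub_comm]; exact hsep1 m n h
  obtain ⟨σ, hA, hB, hσ⟩ := loops x τ b c hb hsep hc0 hcl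
  have hσ0 : σ 0 = x := hB 0 fun n => by
    rw [zero_sub, abs_neg, abs_of_pos (hτ n)]; linarith [hb4 n, hτ n]
  have hσ1 : σ 1 = z 0 := by
    have e : τ 0 = 1 := by simp [hτdef]
    rw [hA 0 1 (by rw [e]; simpa using (hb 0).le), e]
    simpa using hc1 0
  have h1 := hug 1 σ zero_le_one
    (LipschitzOnWith.of_dist_le_mul fun s _ t _ => by simpa [Real.dist_eq] using hσ s t)
    (fun _ _ => Set.mem_univ _)
  rw [hσ0, hσ1] at h1
  have hpos : 0 < ∫ t in (0:ℝ)..1, g (σ t) := by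
    refine lt_of_lt_of_le (hδ.trans_le (hz2 0)) ?_
    rwa [Real.dist_eq]
  have hint : IntervalIntegrable (fun t => g (σ t)) volume 0 1 := by
    by_contra hni
    rw [intervalIntegral.integral_undef hni] at hpos
    exact lt_irrefl _ hpos
  set F : ℝ → ℝ := fun t => ∫ s in (0:ℝ)..t, g (σ s) with hF
  have hFc : ContinuousOn F (Icc 0 1) := by
    have := intervalIntegral.continuousOn_primitive_interval' hint (a := 0) (by simp)
    rwa [uIcc_of_le zero_le_one] at this
  have memτ : ∀ n, τ n ∈ Icc (0:ℝ) 1 := fun n =>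
    ⟨(hτ n).le, pow_le_one₀ (by norm_num) (by norm_num)⟩
  have memτb : ∀ n, τ n - b n ∈ Icc (0:ℝ) 1 := fun n =>
    ⟨by linarith [hb4 n, hτ n], by linarith [hb n, (memτ n).2]⟩
  have hbig : ∀ n, δ ≤ F (τ n) - F (τ n - b n) := by
    intro n
    have hi1 : IntervalIntegrable (fun t => g (σ t)) volume 0 (τ n) :=
      hint.mono_set (by
        rw [uIcc_of_le (memτ n).1, uIcc_of_le zero_le_one]; exact Icc_subset_Icc le_rfl (memτ n).2)
    have hi2 : IntervalIntegrable (fun t => g (σ t)) volume 0 (τ n - b n) :=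
      hint.mono_set (by
        rw [uIcc_of_le (memτb n).1, uIcc_of_le zero_le_one]
        exact Icc_subset_Icc le_rfl (memτb n).2)
    simp only [hF]
    rw [intervalIntegral.integral_interval_sub_left hi1 hi2]
    have e1 : ∫ t in (τ n - b n)..τ n, g (σ t) = ∫ t in (τ n - b n)..τ n, g (c n (t - (τ n - b n))) := by
      refine intervalIntegral.integral_congr fun t ht => ?_
      rw [uIcc_of_le (by linarith [hb n])] at ht
      have : |t - τ n| = τ n - t := by rw [abs_of_nonpos (by linarith [ht.2])]; ring
      change g (σ t) = g (c n (t - (τ n - b n)))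
      rw [hA n t (by rw [this]; linarith [ht.1]), this]
      congr 2; ring
    rw [e1, intervalIntegral.integral_comp_sub_right (fun t => g (c n t)) (τ n - b n)]
    have h2 := hug (b n) (c n) (hb n).le (hcl n) (fun _ _ => Set.mem_univ _)
    rw [hc1 n, hc0 n] at h2
    have h3 := hz2 n
    rw [Real.dist_eq] at h3
    rw [sub_self, _root_.sub_sub_cancel]
    exact h3.trans h2
  have tτ : Tendsto τ atTop (𝓝 0) := tendsto_pow_atTop_nhds_zero_of_lt_one (by norm_num) (by norm_num)
  have tτb : Tendsto (fun n => τ n - b n) atTop (𝓝 0) :=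
    squeeze_zero (fun n => (memτb n).1) (fun n => by linarith [hb n]) tτ
  have hF0 := hFc 0 (by simp)
  have l1 : Tendsto (fun n => F (τ n)) atTop (𝓝 (F 0)) :=
    hF0.tendsto.comp (tendsto_nhdsWithin_iff.2 ⟨tτ, Eventually.of_forall memτ⟩)
  have l2 : Tendsto (fun n => F (τ n - b n)) atTop (𝓝 (F 0)) :=
    hF0.tendsto.comp (tendsto_nhdsWithin_iff.2 ⟨tτb, Eventually.of_forall memτb⟩)
  have := ge_of_tendsto' (l1.sub l2) hbig
  linarith

open Topology in
theorem mass_lower {Y : Type*} [MetricSpace Y] [MeasurableSpace Y]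
    {μ : Measure Y} {q Cμ : ℝ} (hq0 : 0 < q) (hdb : IsDoubling μ Cμ) (x0 : Y)
    (hliminf : 0 < Filter.liminf
        (fun r : ℝ => μ (Metric.ball x0 r) / ENNReal.ofReal (r ^ q))
        (nhdsWithin 0 (Set.Ioi 0))) (S : ℝ) (hS : 0 < S) :
    ∃ c : ℝ, 0 < c ∧ ∀ s, 0 < s → s ≤ S → c * s ^ q ≤ μ.real (ball x0 s) := by
  obtain ⟨c0, hc0, hc1⟩ := exists_between hliminf
  have hev := Filter.eventually_lt_of_lt_liminf hc1
  rw [eventually_nhdsWithin_iff, Metric.eventually_nhds_iff] at hev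
  obtain ⟨δ, hδ, hd⟩ := hev
  have hct : c0 ≠ ⊤ := (lt_of_lt_of_le hc1 le_top).ne
  have hcp : 0 < c0.toReal := ENNReal.toReal_pos hc0.ne' hct
  have small : ∀ s, 0 < s → s < δ → c0.toReal * s ^ q ≤ μ.real (ball x0 s) := by
    intro s hs hsd
    have h1 := hd (y := s) (by rw [Real.dist_eq, sub_zero, abs_of_pos hs]; exact hsd) hs
    have h2 : c0 * ENNReal.ofReal (s ^ q) ≤ μ (ball x0 s) := by
      have := ENNReal.mul_le_of_le_div h1.le
      exact this
    have h3 := ENNReal.toReal_mono (dbl_fin hdb x0 s).ne h2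
    rwa [ENNReal.toReal_mul, ENNReal.toReal_ofReal (by positivity)] at h3
  refine ⟨min c0.toReal (c0.toReal * (δ/2)^q / S^q), lt_min hcp (by positivity), fun s hs hsS => ?_⟩
  rcases lt_or_ge s δ with h | h
  · refine le_trans ?_ (small s hs h)
    gcongr
    exact min_le_left _ _
  · have h1 : μ.real (ball x0 (δ/2)) ≤ μ.real (ball x0 s) :=
      measureReal_mono (ball_subset_ball (by linarith)) (dbl_fin hdb _ _).ne
    refine le_trans ?_ ((small (δ/2) (by positivity) (by linarith)).trans h1)
    calc _ ≤ (c0.toReal * (δ/2)^q / S^q) * S ^ q := by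
          gcongr
          exact min_le_right _ _
      _ = _ := by
          have : 0 < S ^ q := by positivity
          field_simp

theorem stmt5 {Y : Type*} [MetricSpace Y] [MeasurableSpace Y] [BorelSpace Y]
    [CompleteSpace Y]
    (μ : Measure Y) (p q Cμ CP lam : ℝ) (hp : 1 < p) (hq0 : 0 < q) (hqp : q < p)
    (hCμ : 1 ≤ Cμ) (hCP : 0 < CP) (hlam : 1 ≤ lam)
    (hdb : IsDoubling μ Cμ) (hPI : PoincareIneq μ p CP lam)
    (x0 : Y)
    (hliminf : 0 < Filter.liminf
        (fun r : ℝ => μ (Metric.ball x0 r) / ENNReal.ofReal (r ^ q))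
        (nhdsWithin 0 (Set.Ioi 0)))
    (r0 : ℝ) (hr0 : 0 < r0)
    (hne : ((Metric.ball x0 (2 * r0))ᶜ : Set Y).Nonempty) :
    0 < varCap μ p {x0} (Metric.ball x0 r0)ᶜ Set.univ := by
  have hC0 : 0 ≤ Cμ := by linarith
  have hp0 : 0 < p := by linarith
  obtain ⟨K, hK, hqc⟩ := quasiconvex hCμ hCP hlam hdb hPI
  obtain ⟨w, hw⟩ := hne
  have hw : 2 * r0 ≤ dist w x0 := by simpa using hw
  set R := dist w x0 + r0 with hRdef
  have hR : 0 < R := by positivity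
  have hlR : 0 < lam * R := by positivity
  obtain ⟨c, hc, hmass⟩ := mass_lower hq0 hdb x0 hliminf (lam * R) hlR
  have hBR := (dbl_real hC0 hdb x0 R hR).1
  have hBw := (dbl_real hC0 hdb w r0 hr0).1
  set η := μ.real (ball w r0) / μ.real (ball x0 R) with hη
  have hη0 : 0 < η := by positivity
  set θ : ℝ := (1/2:ℝ) ^ (1 - q / p) with hθ
  have hqp1 : 0 < 1 - q / p := by rw [sub_pos, div_lt_one hp0]; exact hqp
  have hθ0 : 0 ≤ θ := by positivity
  have hθ1 : θ < 1 := Real.rpow_lt_one (by norm_num) (by norm_num) hqp1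
  set D0 : ℝ := CP * R / (c * (lam * R) ^ q) ^ (1/p) with hD0
  have hD0p : 0 < D0 := by positivity
  set S := Cμ * D0 / (1 - θ) with hS
  have hSp : 0 < S := div_pos (by positivity) (by linarith)
  have hκ : 0 < (η / S) ^ p := by positivity
  refine lt_of_lt_of_le (ENNReal.ofReal_pos.2 hκ) ?_
  unfold varCap
  refine le_iInf fun u => le_iInf fun g => le_iInf fun hgm => le_iInf fun hg0 => le_iInf fun hug =>
    le_iInf fun hu1 => le_iInf fun hu0 => ?_
  rw [Measure.restrict_univ]
  by_cases htop : ∫⁻ x, ENNReal.ofReal (g x ^ p) ∂μ = ⊤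
  · rw [htop]; exact le_top
  have hgp0 : ∀ x, 0 ≤ g x ^ p := fun x => Real.rpow_nonneg (hg0 x) p
  have hgint : Integrable (fun x => g x ^ p) μ :=
    (lintegral_ofReal_ne_top_iff_integrable (hgm.pow_const p).aestronglyMeasurable
      (ae_of_all _ hgp0)).1 htop
  set G := ∫ x, g x ^ p ∂μ with hG
  have hG0 : 0 ≤ G := integral_nonneg hgp0
  rw [← ofReal_integral_eq_lintegral_ofReal hgint (ae_of_all _ hgp0)]
  refine ENNReal.ofReal_le_ofReal ?_
  -- the truncation
  set v : Y → ℝ := fun y => max 0 (min (u y) 1) with hv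
  have huc := ug_continuous hK hqc u g hug
  have hvc : Continuous v := continuous_const.max (huc.min continuous_const)
  have hv0 : ∀ y, 0 ≤ v y := fun y => le_max_left _ _
  have hv1 : ∀ y, v y ≤ 1 := fun y => max_le zero_le_one (min_le_right _ _)
  have hvx : v x0 = 1 := by
    have := hu1 x0 rfl
    simp [hv, this]
  have hvug : IsUpperGradientOn v g Set.univ := by
    intro L γ hL hγ hm
    refine le_trans ?_ (hug L γ hL hγ hm)
    simp only [hv]
    refine (abs_max_sub_max_le_max _ _ _ _).trans ?_
    rw [sub_self, abs_zero, max_eq_right (abs_nonneg _)]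
    refine (abs_min_sub_min_le_max _ _ _ _).trans ?_
    rw [sub_self, abs_zero, max_eq_left (abs_nonneg _)]
  have hvi := integrable_bdd hdb hvc 1 (fun y => by rw [abs_of_nonneg (hv0 y)]; exact hv1 y)
  -- telescoping
  have htel := telescope hC0 hdb hvc hvi x0 R hR (D0 * G ^ (1/p)) θ (by positivity) hθ0 hθ1 (by
    intro k
    set t : ℝ := (1/2:ℝ)^k with ht
    have ht0 : 0 < t := by positivity
    have ht1 : t ≤ 1 := pow_le_one₀ (by norm_num) (by norm_num)
    have h1 := hPI x0 (R * t) v g (by positivity) hgm hg0 hvug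
    refine h1.trans ?_
    have hs0 : 0 < lam * (R * t) := by positivity
    have hm := hmass (lam * (R * t)) hs0 (by nlinarith)
    have hav : ⨍ y in ball x0 (lam * (R * t)), g y ^ p ∂μ ≤ G / (c * (lam * (R * t)) ^ q) := by
      rw [setAverage_eq, smul_eq_mul, inv_mul_eq_div]
      gcongr
      exact setIntegral_le_integral hgint (ae_of_all _ hgp0)
    have hav0 : 0 ≤ ⨍ y in ball x0 (lam * (R * t)), g y ^ p ∂μ := by
      rw [setAverage_eq, smul_eq_mul]
      exact mul_nonneg (by positivity) (integral_nonneg hgp0)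
    have hθk : θ ^ k = t / t ^ (q/p) := by
      rw [hθ, ht, ← Real.rpow_natCast, ← Real.rpow_mul (by norm_num), mul_comm,
        Real.rpow_mul (by norm_num), Real.rpow_natCast, Real.rpow_sub ht0, Real.rpow_one]
    have e : (c * (lam * (R * t)) ^ q) ^ (1/p) = (c * (lam * R) ^ q) ^ (1/p) * t ^ (q/p) := by
      rw [← mul_assoc lam R t, Real.mul_rpow hlR.le ht0.le, ← mul_assoc,
        Real.mul_rpow (by positivity) (by positivity), ← Real.rpow_mul ht0.le]
      congr 2; ring
    calc _ ≤ CP * (R * t) * (G / (c * (lam * (R * t)) ^ q)) ^ (1/p) := by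
          gcongr
      _ = _ := by
          rw [Real.div_rpow hG0 (by positivity), e, hθk, hD0]
          have : 0 < (c * (lam * R) ^ q) ^ (1/p) := by positivity
          have : 0 < t ^ (q/p) := by positivity
          field_simp)
  have hvw : ∀ y ∈ ball w r0, v y = 0 := by
    intro y hy
    have h1 := hu0 y (by
      simp only [mem_compl_iff, mem_ball, not_lt]
      have := dist_triangle w y x0
      have := mem_ball.1 hy
      rw [dist_comm] at this
      linarith)
    simp only [hv]
    exact max_eq_left ((min_le_left _ _).trans h1)
  have hsub : ball w r0 ⊆ ball x0 R := ball_subset_ball' (by rw [hRdef]; linarith)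
  have havg : ⨍ y in ball x0 R, v y ∂μ ≤ 1 - η := by
    have i1 : Integrable (fun _ : Y => (1:ℝ)) (μ.restrict (ball x0 R)) :=
      integrableOn_const (dbl_fin hdb _ _).ne
    have i2 : Integrable ((ball w r0).indicator (fun _ => (1:ℝ))) (μ.restrict (ball x0 R)) :=
      i1.indicator measurableSet_ball
    have h1 : ∫ y in ball x0 R, v y ∂μ ≤ ∫ y in ball x0 R, (1 - (ball w r0).indicator (fun _ => (1:ℝ)) y) ∂μ := by
      refine integral_mono (hvi x0 R) ?_ fun y => ?_
      · exact i1.sub i2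
      · by_cases hy : y ∈ ball w r0
        · simp [hvw y hy, hy]
        · simp only [Set.indicator_of_notMem hy, sub_zero]; exact hv1 y
    rw [integral_sub i1 i2,
      setIntegral_indicator measurableSet_ball, setIntegral_const, setIntegral_const,
      Set.inter_eq_right.2 hsub] at h1
    simp only [smul_eq_mul, mul_one] at h1
    rw [setAverage_eq, smul_eq_mul, inv_mul_le_iff₀ hBR, hη]
    refine h1.trans_eq ?_
    field_simp
  rw [hvx] at htel
  have hfin : η ≤ S * G ^ (1/p) := by
    have h1 : Cμ * (D0 * G ^ (1/p)) / (1 - θ) = S * G ^ (1/p) := by rw [hS]; ring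
    rw [h1] at htel
    have := (abs_le.1 htel).1
    linarith
  have h3 : η / S ≤ G ^ (1/p) := by rw [div_le_iff₀ hSp]; linarith
  calc (η / S) ^ p ≤ (G ^ (1/p)) ^ p := by gcongr
    _ = G := by rw [← Real.rpow_mul hG0, one_div, inv_mul_cancel₀ hp0.ne', Real.rpow_one]
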